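/- Let H be a nonzero complex Hilbert space, T ∈ B(H), I the identity operator, and θ ∈ [0, 2π). Then D^θ_ω(I, T) = lim_{r→0⁺} (ω(I + r e^{iθ} T)² − 1)/(2r) = sup{Re(e^{iθ}⟨Tx, x⟩) : x ∈ H, ‖x‖ = 1}. -/

import Mathlib

open Filter Topology
open scoped InnerProductSpace

variable {H : Type*} [NormedAddCommGroup H] [InnerProductSpace ℂ H] [CompleteSpace H]

/-- The numerical radius of a bounded operator `T`:
`ω(T) = sup {|⟨Tx, x⟩| : ‖x‖ = 1}`. -/
noncomputable def nrad (T : H →L[ℂ] H) : ℝ :=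
  sSup {r : ℝ | ∃ x : H, ‖x‖ = 1 ∧ r = ‖⟪x, T x⟫_ℂ‖}

/-- Approximate numerical-radius (Birkhoff) orthogonality:
`T ⊥ε_ω S` iff `ω(T + λS)² ≥ ω(T)² − 2ε ω(T) ω(λS)` for all `λ ∈ ℂ`. -/
def NradOrth (ε : ℝ) (T S : H →L[ℂ] H) : Prop :=
  ∀ μ : ℂ, nrad T ^ 2 - 2 * ε * nrad T * nrad (μ • S) ≤ nrad (T + μ • S) ^ 2

omit [CompleteSpace H] in
theorem norm_inner_apply_le_of_norm_eq_one (T : H →L[ℂ] H) {x : H} (hx : ‖x‖ = 1) :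
    ‖⟪x, T x⟫_ℂ‖ ≤ ‖T‖ := by
  have h := (norm_inner_le_norm (𝕜 := ℂ) x (T x)).trans
    (mul_le_mul_of_nonneg_left (T.le_opNorm x) (norm_nonneg x))
  simpa [hx] using h

omit [CompleteSpace H] in
theorem norm_inner_le_nrad (T : H →L[ℂ] H) {x : H} (hx : ‖x‖ = 1) :
    ‖⟪x, T x⟫_ℂ‖ ≤ nrad T := by
  refine le_csSup ⟨‖T‖, ?_⟩ ⟨x, hx, rfl⟩
  rintro _ ⟨y, hy, rfl⟩
  exact norm_inner_apply_le_of_norm_eq_one T hy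

omit [CompleteSpace H] in
theorem norm_inner_id_add_smul_sq (T : H →L[ℂ] H) (r : ℝ) (c : ℂ) {x : H} (hx : ‖x‖ = 1) :
    ‖⟪x, ((1 : H →L[ℂ] H) + ((r : ℂ) * c) • T) x⟫_ℂ‖ ^ 2 =
      1 + 2 * r * (c * ⟪x, T x⟫_ℂ).re + r ^ 2 * ‖c * ⟪x, T x⟫_ℂ‖ ^ 2 := by
  have h : ⟪x, ((1 : H →L[ℂ] H) + ((r : ℂ) * c) • T) x⟫_ℂ = 1 + r * (c * ⟪x, T x⟫_ℂ) := by
    simp [inner_self_eq_norm_sq_to_K, hx, mul_assoc]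
  rw [h]
  generalize c * ⟪x, T x⟫_ℂ = z
  simp only [Complex.sq_norm, Complex.normSq_apply, Complex.add_re, Complex.add_im,
    Complex.one_re, Complex.one_im, Complex.re_ofReal_mul, Complex.im_ofReal_mul]
  ring

omit [CompleteSpace H] in
theorem norm_mul_inner_le_of_norm_eq_one (T : H →L[ℂ] H) {c : ℂ} (hc : ‖c‖ = 1) {x : H}
    (hx : ‖x‖ = 1) : ‖c * ⟪x, T x⟫_ℂ‖ ≤ ‖T‖ := by
  simpa [hc] using norm_inner_apply_le_of_norm_eq_one T hx

omit [CompleteSpace H] in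
theorem sSup_re_le_nrad_id_add_smul [Nontrivial H] (T : H →L[ℂ] H) (c : ℂ) {r : ℝ}
    (hr : 0 < r) :
    sSup {t : ℝ | ∃ x : H, ‖x‖ = 1 ∧ t = (c * ⟪x, T x⟫_ℂ).re} ≤
      (nrad ((1 : H →L[ℂ] H) + ((r : ℂ) * c) • T) ^ 2 - 1) / (2 * r) := by
  obtain ⟨x₀, hx₀⟩ := exists_norm_eq H zero_le_one
  refine csSup_le ⟨_, x₀, hx₀, rfl⟩ ?_
  rintro _ ⟨x, hx, rfl⟩
  rw [le_div_iff₀ (by positivity)]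
  have h := pow_le_pow_left₀ (norm_nonneg _)
    (norm_inner_le_nrad ((1 : H →L[ℂ] H) + ((r : ℂ) * c) • T) hx) 2
  rw [norm_inner_id_add_smul_sq T r c hx] at h
  have : 0 ≤ r ^ 2 * ‖c * ⟪x, T x⟫_ℂ‖ ^ 2 := by positivity
  linarith

omit [CompleteSpace H] in
theorem nrad_id_add_smul_le_sSup_re_add [Nontrivial H] (T : H →L[ℂ] H) {c : ℂ}
    (hc : ‖c‖ = 1) {r : ℝ} (hr : 0 < r) :
    (nrad ((1 : H →L[ℂ] H) + ((r : ℂ) * c) • T) ^ 2 - 1) / (2 * r) ≤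
      sSup {t : ℝ | ∃ x : H, ‖x‖ = 1 ∧ t = (c * ⟪x, T x⟫_ℂ).re} + r * ‖T‖ ^ 2 / 2 := by
  set s := sSup {t : ℝ | ∃ x : H, ‖x‖ = 1 ∧ t = (c * ⟪x, T x⟫_ℂ).re} with hs
  have hre (x : H) (hx : ‖x‖ = 1) : (c * ⟪x, T x⟫_ℂ).re ≤ s := by
    refine le_csSup ⟨‖T‖, ?_⟩ ⟨x, hx, rfl⟩
    rintro _ ⟨y, hy, rfl⟩
    exact (Complex.re_le_norm _).trans (norm_mul_inner_le_of_norm_eq_one T hc hy)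
  have hsq (x : H) (hx : ‖x‖ = 1) :
      ‖⟪x, ((1 : H →L[ℂ] H) + ((r : ℂ) * c) • T) x⟫_ℂ‖ ^ 2 ≤
        1 + 2 * r * s + r ^ 2 * ‖T‖ ^ 2 := by
    rw [norm_inner_id_add_smul_sq T r c hx]
    gcongr
    · exact hre x hx
    · exact norm_mul_inner_le_of_norm_eq_one T hc hx
  obtain ⟨x₀, hx₀⟩ := exists_norm_eq H zero_le_one
  have hle : nrad ((1 : H →L[ℂ] H) + ((r : ℂ) * c) • T) ≤
      √(1 + 2 * r * s + r ^ 2 * ‖T‖ ^ 2) := by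
    refine csSup_le ⟨_, x₀, hx₀, rfl⟩ ?_
    rintro _ ⟨x, hx, rfl⟩
    exact Real.le_sqrt_of_sq_le (hsq x hx)
  have h := pow_le_pow_left₀ ((norm_nonneg _).trans (norm_inner_le_nrad _ hx₀)) hle 2
  rw [Real.sq_sqrt ((sq_nonneg _).trans (hsq x₀ hx₀))] at h
  rw [div_le_iff₀ (by positivity)]
  linarith

/-- For a nonzero Hilbert space,
`D^θ_ω(I, T) = lim_{r→0⁺} (ω(I + r e^{iθ} T)² − 1)/(2r) = sup_{‖x‖=1} Re(e^{iθ}⟨Tx, x⟩)`. -/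
theorem nrad_deriv_id (T : H →L[ℂ] H) [Nontrivial H] (θ : ℝ)
    (hθ : θ ∈ Set.Ico (0 : ℝ) (2 * Real.pi)) :
    Tendsto
      (fun r : ℝ =>
        (nrad ((1 : H →L[ℂ] H) + ((r : ℂ) * Complex.exp ((θ : ℂ) * Complex.I)) • T) ^ 2 - 1) /
          (2 * r))
      (𝓝[>] (0 : ℝ))
      (𝓝 (sSup {t : ℝ | ∃ x : H, ‖x‖ = 1 ∧
        t = (Complex.exp ((θ : ℂ) * Complex.I) * ⟪x, T x⟫_ℂ).re})) := by
  refine tendsto_of_tendsto_of_tendsto_of_le_of_le' tendsto_const_nhds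
    (h := fun r : ℝ => sSup {t : ℝ | ∃ x : H, ‖x‖ = 1 ∧
      t = (Complex.exp ((θ : ℂ) * Complex.I) * ⟪x, T x⟫_ℂ).re} + r * ‖T‖ ^ 2 / 2) ?_ ?_ ?_
  · refine tendsto_nhdsWithin_of_tendsto_nhds ?_
    refine Continuous.tendsto' (by fun_prop) _ _ (by simp)
  · filter_upwards [self_mem_nhdsWithin] with r hr
    exact sSup_re_le_nrad_id_add_smul T _ hr
  · filter_upwards [self_mem_nhdsWithin] with r hr
    exact nrad_id_add_smul_le_sSup_re_add T (Complex.norm_exp_ofReal_mul_I θ) hr
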